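/- Let λ₀ > 1 and set C := 1 + 2(λ₀² − 1)^{−1}. Let λ ≥ λ₀, k > 0, and let w be a Schwartz function on ℝ^d. Define the low- and high-frequency parts w_A := 𝓕_k^{−1}( χ_λ · 𝓕_k w ) and w_{H²} := 𝓕_k^{−1}( (1 − χ_λ) · 𝓕_k w ), where χ_λ is the indicator function of {ξ : |ξ| ≤ λ}. Then: (a) w = w_A + w_{H²}; (b) w_A is C^∞ and satisfies ‖(k^{−1}∂)^α w_A‖_{L²(ℝ^d)} ≤ λ^{|α|} ‖w‖_{L²(ℝ^d)} for every multi-index α (in particular w_A is real analytic); and (c) ⫼w_{H²}⫼_{H²_k(ℝ^d)} ≤ C ‖(−k^{−2}Δ − 1)w‖_{L²(ℝ^d)}, where Δ is the Laplacian on ℝ^d. -/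

import Mathlib

open MeasureTheory Complex

noncomputable section

/-- The scaled Fourier transform `𝓕ₖφ(ξ) = ∫ e^{-ik x·ξ} φ(x) dx`. -/
def Fk (d : ℕ) (k : ℝ) (φ : EuclideanSpace ℝ (Fin d) → ℂ) (ξ : EuclideanSpace ℝ (Fin d)) : ℂ :=
  ∫ x : EuclideanSpace ℝ (Fin d), Complex.exp (-(Complex.I * k * (∑ i, x i * ξ i : ℝ))) * φ x

/-- The inverse scaled Fourier transform
`𝓕ₖ⁻¹ψ(x) = (k/(2π))^d ∫ e^{ik x·ξ} ψ(ξ) dξ`. -/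
def FkInv (d : ℕ) (k : ℝ) (ψ : EuclideanSpace ℝ (Fin d) → ℂ) (x : EuclideanSpace ℝ (Fin d)) : ℂ :=
  ((k / (2 * Real.pi)) ^ d : ℝ) *
    ∫ ξ : EuclideanSpace ℝ (Fin d), Complex.exp (Complex.I * k * (∑ i, x i * ξ i : ℝ)) * ψ ξ

/-- Partial derivative in the `i`-th coordinate direction. -/
def pd (d : ℕ) (i : Fin d) (f : EuclideanSpace ℝ (Fin d) → ℂ) :
    EuclideanSpace ℝ (Fin d) → ℂ :=
  fun x => fderiv ℝ f x (EuclideanSpace.single i 1)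

/-- Iterated multi-index partial derivative `∂^α`. -/
def pdAlpha (d : ℕ) (α : Fin d → ℕ) (f : EuclideanSpace ℝ (Fin d) → ℂ) :
    EuclideanSpace ℝ (Fin d) → ℂ :=
  (List.finRange d).foldr (fun i g => (pd d i)^[α i] g) f

/-- The Laplacian `Δf = Σᵢ ∂ᵢ²f`. -/
def lap (d : ℕ) (f : EuclideanSpace ℝ (Fin d) → ℂ) : EuclideanSpace ℝ (Fin d) → ℂ :=
  fun x => ∑ i, pd d i (pd d i f) x

/-- The indicator function `χ_λ` of the ball `{ξ : |ξ| ≤ λ}`, as a symbol. -/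
def chiBall (d : ℕ) (lam : ℝ) (ξ : EuclideanSpace ℝ (Fin d)) : ℂ :=
  if ‖ξ‖ ≤ lam then 1 else 0

/-- The weighted Fourier-side Sobolev norm `⫼·⫼_{H^s_k}` applied to the frequency-side
function `g = 𝓕ₖ u`: `⫼u⫼²_{H^s_k} = (k/(2π))^d ∫ (1+|ξ|²)^s |𝓕ₖu(ξ)|² dξ`. -/
def wNormF (d : ℕ) (k s : ℝ) (g : EuclideanSpace ℝ (Fin d) → ℂ) : ℝ :=
  Real.sqrt ((k / (2 * Real.pi)) ^ d *
    ∫ ξ : EuclideanSpace ℝ (Fin d), (1 + ‖ξ‖ ^ 2) ^ s * ‖g ξ‖ ^ 2)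

/-- The `L²(ℝ^d)` norm. -/
def l2Norm (d : ℕ) (f : EuclideanSpace ℝ (Fin d) → ℂ) : ℝ :=
  Real.sqrt (∫ x : EuclideanSpace ℝ (Fin d), ‖f x‖ ^ 2)

section aux

open FourierTransform SchwartzMap

variable {V : Type*} [NormedAddCommGroup V] [InnerProductSpace ℝ V] [FiniteDimensional ℝ V]
  [MeasurableSpace V] [BorelSpace V]

lemma aux_fourier_ae (h : V → ℂ) (h1 : Integrable h) (h2 : MemLp h 2 volume) :
    ((𝓕 (h2.toLp h) : Lp ℂ 2 (volume : Measure V)) : V → ℂ) =ᵐ[volume] 𝓕 h := by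
  have hc : Continuous (𝓕 h) := VectorFourier.fourierIntegral_continuous
    Real.continuous_fourierChar continuous_inner h1
  apply ae_eq_of_integral_contDiff_smul_eq
  · exact MemLp.locallyIntegrable (μ := volume) (p := 2) (Lp.memLp _) (by norm_num)
  · exact hc.locallyIntegrable
  intro g hg hgs
  have hg' : ContDiff ℝ (⊤ : ℕ∞) (fun x => (g x : ℂ)) := Complex.ofRealCLM.contDiff.comp hg
  have hgs' : HasCompactSupport (fun x => (g x : ℂ)) := hgs.comp_left (g := fun t : ℝ => (t : ℂ)) (by simp)
  let φ : 𝓢(V, ℂ) := hgs'.toSchwartzMap hg'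
  have hφ : ∀ x, φ x = (g x : ℂ) := fun x => rfl
  have key := congrArg (fun T => T φ) (Lp.fourier_toTemperedDistribution_eq (h2.toLp h))
  simp only [TemperedDistribution.fourier_apply, Lp.toTemperedDistribution_apply] at key
  have e1 : ∀ (u : V → ℂ), ∫ x, g x • u x = ∫ x, φ x • u x := by
    intro u; congr 1
  rw [e1, e1, ← key]
  have e2 : ∫ x, (𝓕 φ) x • (h2.toLp h : V → ℂ) x = ∫ x, (𝓕 φ) x • h x := by
    apply integral_congr_ae
    filter_upwards [h2.coeFn_toLp] with x hx
    rw [hx]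
  rw [e2]
  have := VectorFourier.integral_fourierIntegral_smul_eq_flip (L := innerₗ V) (μ := volume)
    (ν := volume) Real.continuous_fourierChar continuous_inner φ.integrable h1
  rw [flip_innerₗ] at this
  exact this

lemma aux_plancherel (h : V → ℂ) (h1 : Integrable h) (h2 : MemLp h 2 volume) :
    eLpNorm (𝓕 h) 2 volume = eLpNorm h 2 volume := by
  rw [← eLpNorm_congr_ae (aux_fourier_ae h h1 h2), ← eLpNorm_congr_ae h2.coeFn_toLp]
  have := Lp.norm_fourier_eq (h2.toLp h)
  rw [Lp.norm_def, Lp.norm_def] at this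
  exact (ENNReal.toReal_eq_toReal_iff' (Lp.eLpNorm_ne_top _) (Lp.eLpNorm_ne_top _)).1 this

lemma aux_analytic (R : ℝ) (h : V → ℂ) (h1 : Integrable h) (h0 : ∀ v, R < ‖v‖ → h v = 0) :
    AnalyticOnNhd ℝ (𝓕 h) Set.univ := by
  let K : Set V := Metric.closedBall 0 R
  have : CompactSpace K := isCompact_iff_compactSpace.1 (isCompact_closedBall 0 R)
  have hK : MeasurableSet K := Metric.isClosed_closedBall.measurableSet
  let ν : Measure K := Measure.comap Subtype.val volume
  have hi : Integrable (fun v : K => h v) ν :=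
    (MeasurableEmbedding.subtype_coe hK).integrable_map_iff.1 (by
      rw [show Measure.map (Subtype.val : K → V) ν = volume.restrict K from
        map_comap_subtype_coe hK volume]
      exact h1.restrict)
  let L0 : V →ₗ[ℝ] C(K, ℂ) :=
    { toFun := fun x => ⟨fun v => ((-2 * Real.pi * inner ℝ (v : V) x : ℝ) : ℂ) * I, by fun_prop⟩
      map_add' := by
        intro x y; ext v; simp [inner_add_right]; ring
      map_smul' := by
        intro c x; ext v; simp [inner_smul_right]; ring }
  let L : V →L[ℝ] C(K, ℂ) := LinearMap.toContinuousLinearMap L0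
  have hint : ∀ f : C(K, ℂ), Integrable (fun v : K => f v * h v) ν := fun f =>
    hi.bdd_mul (c := ‖f‖) f.continuous.aestronglyMeasurable
      (Filter.Eventually.of_forall fun v => f.norm_coe_le_norm v)
  let T0 : C(K, ℂ) →ₗ[ℝ] ℂ :=
    { toFun := fun f => ∫ v : K, f v * h v ∂ν
      map_add' := by
        intro f g
        simp only [ContinuousMap.add_apply, add_mul]
        exact integral_add (hint f) (hint g)
      map_smul' := by
        intro c f
        simp only [ContinuousMap.smul_apply, smul_mul_assoc, RingHom.id_apply]
        exact integral_smul _ _ }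
  let T : C(K, ℂ) →L[ℝ] ℂ := T0.mkContinuous (∫ v : K, ‖h v‖ ∂ν) (by
    intro f
    refine (norm_integral_le_integral_norm _).trans ?_
    rw [← integral_mul_const]
    refine integral_mono (hint f).norm (hi.norm.mul_const _) fun v => ?_
    simp only [norm_mul]
    rw [mul_comm]
    gcongr
    exact f.norm_coe_le_norm v)
  have hrep : 𝓕 h = fun x => T (NormedSpace.exp (L x)) := by
    ext x
    rw [Real.fourier_eq']
    have e : ∀ v : K, (NormedSpace.exp (L x)) v
        = Complex.exp ((↑(-2 * Real.pi * inner ℝ (v : V) x) * Complex.I)) := by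
      intro v
      have := NormedSpace.map_exp (ContinuousMap.evalAlgHom ℂ ℂ v) 
        (continuous_eval_const v) (L x)
      rw [Complex.exp_eq_exp_ℂ]
      exact this
    change _ = ∫ v : K, (NormedSpace.exp (L x)) v * h v ∂ν
    simp_rw [e]
    rw [integral_subtype_comap hK (fun v => Complex.exp ((↑(-2 * Real.pi * inner ℝ (v : V) x) * Complex.I)) * h v)]
    rw [setIntegral_eq_integral_of_forall_compl_eq_zero]
    · rfl
    · intro v hv
      rw [h0 v (by simpa [K] using hv), mul_zero]
  rw [hrep]
  intro x _
  have a1 : AnalyticAt ℝ (fun x => NormedSpace.exp (L x)) x :=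
    (NormedSpace.exp_analytic (𝕂 := ℝ) (L x)).comp (L.analyticAt x)
  exact (T.analyticAt _).comp a1

lemma aux_deriv (R : ℝ) (hR : 0 ≤ R) (h : V → ℂ) (h1 : Integrable h)
    (h0 : ∀ v, R < ‖v‖ → h v = 0) (m : V) (hm : ‖m‖ ≤ 1) :
    ∃ h' : V → ℂ, Integrable h' ∧ (∀ v, R < ‖v‖ → h' v = 0) ∧
      (∀ v, ‖h' v‖ ≤ (2 * Real.pi * R) * ‖h v‖) ∧
      (fun x => fderiv ℝ (𝓕 h) x m) = 𝓕 h' := by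
  have hv : Integrable (fun v => ‖v‖ * ‖h v‖) := by
    refine (h1.norm.const_mul R).mono' (by fun_prop) (Filter.Eventually.of_forall fun v => ?_)
    by_cases hb : R < ‖v‖
    · simp [h0 v hb]
    · rw [norm_mul, norm_norm, norm_norm]
      gcongr
      exact not_lt.1 hb
  have hb : ∀ v, ‖-(2 * Real.pi * I * (inner ℝ v m : ℝ)) * h v‖ ≤ (2 * Real.pi * R) * ‖h v‖ := by
    intro v
    by_cases hb : R < ‖v‖
    · simp [h0 v hb]
    · rw [norm_mul]
      gcongr
      simp only [norm_neg, norm_mul, Complex.norm_real, Complex.norm_I, Complex.norm_ofNat, mul_one]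
      rw [Real.norm_of_nonneg Real.pi_pos.le]
      gcongr
      calc ‖inner ℝ v m‖ ≤ ‖v‖ * ‖m‖ := norm_inner_le_norm _ _
        _ ≤ R * 1 := by gcongr; exact not_lt.1 hb
        _ = R := mul_one R
  have hmeas : AEStronglyMeasurable (fun v => -(2 * Real.pi * I * (inner ℝ v m : ℝ)) * h v) volume := by
    refine AEStronglyMeasurable.mul ?_ h1.1
    exact Continuous.aestronglyMeasurable (by fun_prop)
  refine ⟨fun v => -(2 * Real.pi * I * (inner ℝ v m : ℝ)) * h v, ?_, ?_, hb, ?_⟩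
  · exact (h1.norm.const_mul (2 * Real.pi * R)).mono' hmeas (Filter.Eventually.of_forall hb)
  · intro v hv; simp [h0 v hv]
  · ext x
    rw [Real.fderiv_fourier h1 hv]
    have hi : Integrable (VectorFourier.fourierSMulRight (innerSL ℝ) h) := by
      refine ((hv.const_mul (2 * Real.pi * ‖(innerSL ℝ : V →L[ℝ] V →L[ℝ] ℝ)‖))).mono'
        h1.1.fourierSMulRight (Filter.Eventually.of_forall fun v => ?_)
      refine (VectorFourier.norm_fourierSMulRight_le _ _ _).trans (le_of_eq (by ring))
    rw [Real.fourier_continuousLinearMap_apply hi]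
    refine congrArg (fun F : V → ℂ => 𝓕 F x) (funext fun v => ?_)
    rw [VectorFourier.fourierSMulRight_apply, innerSL_apply_apply]
    simp
    ring

end aux

section aux2

open FourierTransform SchwartzMap Laplacian LineDeriv

lemma aux_inner {d : ℕ} (x y : EuclideanSpace ℝ (Fin d)) : inner ℝ x y = ∑ i, x i * y i := by
  simp [PiLp.inner_apply, mul_comm]

lemma aux_Fk {d : ℕ} (k : ℝ) (w : EuclideanSpace ℝ (Fin d) → ℂ) (ξ : EuclideanSpace ℝ (Fin d)) :
    Fk d k w ξ = 𝓕 w ((k / (2 * Real.pi)) • ξ) := by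
  rw [Real.fourier_eq', Fk]
  congr 1
  ext x
  rw [inner_smul_right, aux_inner, smul_eq_mul]
  congr 2
  have : (Real.pi : ℂ) ≠ 0 := by exact_mod_cast Real.pi_ne_zero
  push_cast
  field_simp

lemma aux_FkInv {d : ℕ} (k : ℝ) (hk : 0 < k) (ψ : EuclideanSpace ℝ (Fin d) → ℂ) :
    FkInv d k ψ = 𝓕⁻ (fun η => ψ ((k / (2 * Real.pi))⁻¹ • η)) := by
  ext x
  have hc : 0 < k / (2 * Real.pi) := by positivity
  have := Measure.integral_comp_inv_smul_of_nonneg (μ := (volume : Measure (EuclideanSpace ℝ (Fin d))))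
    (fun ξ => Complex.exp (Complex.I * k * (∑ i, x i * ξ i : ℝ)) * ψ ξ) hc.le
  rw [finrank_euclideanSpace_fin] at this
  rw [Real.fourierInv_eq', FkInv, ← Complex.real_smul, ← this]
  congr 1
  ext v
  rw [smul_eq_mul]
  congr 2
  rw [real_inner_comm, ← aux_inner, inner_smul_right]
  have : (Real.pi : ℂ) ≠ 0 := by exact_mod_cast Real.pi_ne_zero
  have : (k : ℂ) ≠ 0 := by exact_mod_cast hk.ne'
  push_cast
  field_simp

/-- `f` is a Fourier transform of a function supported in the `R`-ball, dominated by `h`. -/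
def auxP (d : ℕ) (R : ℝ) (h : EuclideanSpace ℝ (Fin d) → ℂ) (n : ℕ)
    (f : EuclideanSpace ℝ (Fin d) → ℂ) : Prop :=
  ∃ h' : EuclideanSpace ℝ (Fin d) → ℂ, Integrable h' ∧ (∀ v, R < ‖v‖ → h' v = 0) ∧
      (∀ v, ‖h' v‖ ≤ (2 * Real.pi * R) ^ n * ‖h v‖) ∧ f = 𝓕 h'

lemma auxP_step {d : ℕ} {R : ℝ} (hR : 0 ≤ R) {h : EuclideanSpace ℝ (Fin d) → ℂ} {n : ℕ}
    {f : EuclideanSpace ℝ (Fin d) → ℂ} (hf : auxP d R h n f) (i : Fin d) :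
    auxP d R h (n + 1) (pd d i f) := by
  obtain ⟨h', h1, h0, hb, rfl⟩ := hf
  obtain ⟨h'', g1, g0, gb, ge⟩ := aux_deriv R hR h' h1 h0 (EuclideanSpace.single i 1) (by simp)
  refine ⟨h'', g1, g0, fun v => (gb v).trans ?_, ge⟩
  rw [pow_succ', mul_assoc (2 * Real.pi * R)]
  exact mul_le_mul_of_nonneg_left (hb v) (by positivity)

lemma auxP_iter {d : ℕ} {R : ℝ} (hR : 0 ≤ R) {h : EuclideanSpace ℝ (Fin d) → ℂ} {n : ℕ}
    {f : EuclideanSpace ℝ (Fin d) → ℂ} (hf : auxP d R h n f) (i : Fin d) (a : ℕ) :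
    auxP d R h (a + n) ((pd d i)^[a] f) := by
  induction a with
  | zero => simpa using hf
  | succ a ih =>
    rw [Function.iterate_succ_apply', show a + 1 + n = a + n + 1 by ring]
    exact auxP_step hR ih i

lemma auxP_alpha {d : ℕ} {R : ℝ} (hR : 0 ≤ R) {h : EuclideanSpace ℝ (Fin d) → ℂ}
    {f : EuclideanSpace ℝ (Fin d) → ℂ} (hf : auxP d R h 0 f) (α : Fin d → ℕ) :
    auxP d R h (∑ i, α i) (pdAlpha d α f) := by
  rw [Fin.sum_univ_def, pdAlpha]
  induction List.finRange d with
  | nil => simpa using hf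
  | cons i l ih =>
    rw [List.map_cons, List.sum_cons, List.foldr_cons]
    exact auxP_iter hR ih i (α i)

lemma aux_fourier_lap {d : ℕ} (w : 𝓢(EuclideanSpace ℝ (Fin d), ℂ)) (η : EuclideanSpace ℝ (Fin d)) :
    (𝓕 (Δ w)) η = -(((2 * Real.pi) ^ 2 * ‖η‖ ^ 2 : ℝ) : ℂ) * (𝓕 w) η := by
  rw [laplacian_eq_fourierMultiplierCLM, fourierMultiplierCLM_apply]
  have : (fun x : EuclideanSpace ℝ (Fin d) => ‖x‖ ^ 2).HasTemperateGrowth := by fun_prop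
  have e : -(2 * Real.pi) ^ 2 • 𝓕⁻ (smulLeftCLM ℂ (fun x : EuclideanSpace ℝ (Fin d) => ‖x‖ ^ 2) (𝓕 w))
    = ((-(2 * Real.pi) ^ 2 : ℝ) : ℂ) • 𝓕⁻ (smulLeftCLM ℂ (fun x : EuclideanSpace ℝ (Fin d) => ‖x‖ ^ 2) (𝓕 w)) := by
    ext x; simp
  rw [e, FourierTransform.fourier_smul, FourierTransform.fourier_fourierInv_eq]
  simp [this]
  ring

lemma aux_lap {d : ℕ} (w : 𝓢(EuclideanSpace ℝ (Fin d), ℂ)) (x : EuclideanSpace ℝ (Fin d)) :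
    lap d (fun y => w y) x = (Δ w) x := by
  rw [SchwartzMap.laplacian_eq_sum (EuclideanSpace.basisFun (Fin d) ℝ)]
  simp only [lap, pd, _root_.sum_apply, EuclideanSpace.basisFun_apply]
  refine Finset.sum_congr rfl fun i _ => ?_
  rw [SchwartzMap.lineDerivOp_apply_eq_fderiv]
  rfl

end aux2

/-- **The high/low frequency splitting of a function.**
Let `λ₀ > 1`, `C := 1 + 2(λ₀²−1)⁻¹`, `λ ≥ λ₀`, `k > 0`, and let `w` be Schwartz.  With
`w_A := 𝓕ₖ⁻¹(χ_λ ⬝ 𝓕ₖw)` and `w_{H²} := 𝓕ₖ⁻¹((1−χ_λ) ⬝ 𝓕ₖw)`: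
(a) `w = w_A + w_{H²}`;
(b) `w_A` is `C^∞` with `‖(k⁻¹∂)^α w_A‖_{L²} ≤ λ^{|α|}‖w‖_{L²}` for every multi-index
    `α`, and in particular `w_A` is real analytic on `ℝ^d`;
(c) `⫼w_{H²}⫼_{H²_k} ≤ C ‖(−k⁻²Δ−1)w‖_{L²}` (the weighted norm of `w_{H²}` being
    expressed via its scaled Fourier transform `(1−χ_λ) ⬝ 𝓕ₖw`). -/
theorem frequency_splitting
    {d : ℕ} (lam₀ : ℝ) (hlam₀ : 1 < lam₀) (lam : ℝ) (hlam : lam₀ ≤ lam)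
    (k : ℝ) (hk : 0 < k) (w : SchwartzMap (EuclideanSpace ℝ (Fin d)) ℂ) :
    -- (a)
    (∀ x, w x = FkInv d k (fun ξ => chiBall d lam ξ * Fk d k (fun y => w y) ξ) x
        + FkInv d k (fun ξ => (1 - chiBall d lam ξ) * Fk d k (fun y => w y) ξ) x) ∧
    -- (b)
    (ContDiff ℝ (⊤ : ℕ∞) (FkInv d k (fun ξ => chiBall d lam ξ * Fk d k (fun y => w y) ξ)) ∧
      (∀ α : Fin d → ℕ,
        eLpNorm
          (fun x => ((k : ℂ) ^ (∑ i, α i))⁻¹ *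
            pdAlpha d α (FkInv d k (fun ξ => chiBall d lam ξ * Fk d k (fun y => w y) ξ)) x)
          2 volume
        ≤ ENNReal.ofReal (lam ^ (∑ i, α i)) *
            eLpNorm (fun x => w x) 2 volume) ∧
      AnalyticOnNhd ℝ
        (FkInv d k (fun ξ => chiBall d lam ξ * Fk d k (fun y => w y) ξ)) Set.univ) ∧
    -- (c)
    wNormF d k 2 (fun ξ => (1 - chiBall d lam ξ) * Fk d k (fun y => w y) ξ)
      ≤ (1 + 2 * (lam₀ ^ 2 - 1)⁻¹) *
        l2Norm d (fun x => -((k ^ 2 : ℝ) : ℂ)⁻¹ * lap d (fun y => w y) x - w x) := by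
  have hc : 0 < k / (2 * Real.pi) := by positivity
  set c : ℝ := k / (2 * Real.pi) with hcdef
  have hl0 : 0 ≤ lam := by linarith
  have hW : ∀ η, Fk d k (fun y => w y) (c⁻¹ • η) = (FourierTransform.fourier w) η := by
    intro η
    rw [aux_Fk, ← hcdef, smul_inv_smul₀ hc.ne']
    rfl
  have hchi : ∀ η : EuclideanSpace ℝ (Fin d),
      chiBall d lam (c⁻¹ • η) = if ‖η‖ ≤ c * lam then 1 else 0 := by
    intro η
    have : ‖c⁻¹ • η‖ ≤ lam ↔ ‖η‖ ≤ c * lam := by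
      rw [norm_smul, Real.norm_of_nonneg (by positivity), inv_mul_le_iff₀ hc]
    simp only [chiBall, this]
  have hchi_meas : Measurable (fun η : EuclideanSpace ℝ (Fin d) => chiBall d lam (c⁻¹ • η)) := by
    simp_rw [hchi]
    exact Measurable.ite (measurableSet_le measurable_norm measurable_const)
      measurable_const measurable_const
  have hchi_le : ∀ η : EuclideanSpace ℝ (Fin d), ‖chiBall d lam η‖ ≤ 1 := by
    intro η; unfold chiBall; split_ifs <;> simp
  have hchi_le' : ∀ η : EuclideanSpace ℝ (Fin d), ‖1 - chiBall d lam η‖ ≤ 1 := by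
    intro η; unfold chiBall; split_ifs <;> simp
  let W : SchwartzMap (EuclideanSpace ℝ (Fin d)) ℂ := FourierTransform.fourier w
  have hWi : Integrable (fun η => W η) := W.integrable
  have hA : Integrable (fun η => chiBall d lam (c⁻¹ • η) * W η) :=
    hWi.bdd_mul (c := 1) hchi_meas.aestronglyMeasurable
      (Filter.Eventually.of_forall fun η => hchi_le _)
  have hH : Integrable (fun η => (1 - chiBall d lam (c⁻¹ • η)) * W η) :=
    hWi.bdd_mul (c := 1) (hchi_meas.const_sub 1).aestronglyMeasurable
      (Filter.Eventually.of_forall fun η => hchi_le' _)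
  have eA : FkInv d k (fun ξ => chiBall d lam ξ * Fk d k (fun y => w y) ξ)
      = FourierTransformInv.fourierInv (fun η => chiBall d lam (c⁻¹ • η) * W η) := by
    rw [aux_FkInv k hk]
    simp_rw [← hcdef, hW]
    rfl
  have eH : FkInv d k (fun ξ => (1 - chiBall d lam ξ) * Fk d k (fun y => w y) ξ)
      = FourierTransformInv.fourierInv (fun η => (1 - chiBall d lam (c⁻¹ • η)) * W η) := by
    rw [aux_FkInv k hk]
    simp_rw [← hcdef, hW]
    rfl
  let h : EuclideanSpace ℝ (Fin d) → ℂ := fun η => chiBall d lam (c⁻¹ • (-η)) * W (-η)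
  have eA' : FkInv d k (fun ξ => chiBall d lam ξ * Fk d k (fun y => w y) ξ)
      = FourierTransform.fourier h := by
    rw [eA, Real.fourierInv_eq_fourier_comp_neg]
  have hint : Integrable h := hA.comp_neg
  have hzero : ∀ v, c * lam < ‖v‖ → h v = 0 := by
    intro v hv
    simp only [h]
    rw [hchi, if_neg (by rw [norm_neg]; exact not_le.2 hv), zero_mul]
  have han := aux_analytic (c * lam) h hint hzero
  refine ⟨?_, ⟨?_, ?_, ?_⟩, ?_⟩
  · intro x
    rw [eA, eH, Real.fourierInv_eq, Real.fourierInv_eq]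
    have iA := (Real.fourierIntegral_convergent_iff (μ := volume) (-x)).2 hA
    have iH := (Real.fourierIntegral_convergent_iff (μ := volume) (-x)).2 hH
    simp only [inner_neg_right, neg_neg] at iA iH
    rw [← integral_add iA iH]
    have e1 : w x = (FourierTransformInv.fourierInv (FourierTransform.fourier w)) x := by
      rw [FourierTransform.fourierInv_fourier_eq]
    rw [e1, SchwartzMap.fourierInv_coe, Real.fourierInv_eq]
    congr 1
    ext v
    rw [← smul_add]
    congr 1
    change W v = _
    ring
  · rw [eA']
    exact contDiffOn_univ.1 (han.analyticOn.contDiffOn uniqueDiffOn_univ)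
  · intro α
    rw [eA']
    have hR : 0 ≤ c * lam := by positivity
    have hb0 : auxP d (c * lam) h 0 (FourierTransform.fourier h) :=
      ⟨h, hint, hzero, fun v => by simp, rfl⟩
    obtain ⟨h', i', z', b', e'⟩ := auxP_alpha hR hb0 α
    rw [e']
    set n := ∑ i, α i
    have hWneg : eLpNorm (fun η => W (-η)) 2 volume = eLpNorm (fun x => w x) 2 volume := by
      have m1 : eLpNorm (fun η => W (-η)) 2 volume = eLpNorm (fun η => W η) 2 volume :=
        eLpNorm_comp_measurePreserving (g := fun η => W η) W.continuous.aestronglyMeasurable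
          (Measure.measurePreserving_neg volume)
      rw [m1]
      exact aux_plancherel (fun x => w x) w.integrable (w.memLp 2 volume)
    have hb2 : ∀ v, ‖h' v‖ ≤ (k * lam) ^ n * ‖W (-v)‖ := by
      intro v
      refine (b' v).trans ?_
      have : 2 * Real.pi * (c * lam) = k * lam := by
        rw [hcdef]; field_simp
      rw [this]
      gcongr
      simp only [h, norm_mul]
      exact mul_le_of_le_one_left (norm_nonneg _) (hchi_le _)
    have hm' : MemLp h' 2 volume := by
      have : MemLp (fun η => W (-η)) 2 volume :=
        (W.memLp 2 volume).comp_measurePreserving (Measure.measurePreserving_neg volume)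
      exact this.of_le_mul i'.1 (Filter.Eventually.of_forall hb2)
    have hle := eLpNorm_le_mul_eLpNorm_of_ae_le_mul (μ := volume)
      (Filter.Eventually.of_forall hb2) 2
    rw [hWneg] at hle
    have hconst : eLpNorm (fun x => ((k : ℂ) ^ n)⁻¹ * FourierTransform.fourier h' x) 2 volume
        = ENNReal.ofReal ((k ^ n)⁻¹) * eLpNorm (FourierTransform.fourier h') 2 volume := by
      have := eLpNorm_const_smul (((k : ℂ) ^ n)⁻¹) (FourierTransform.fourier h') 2
        (volume : Measure (EuclideanSpace ℝ (Fin d)))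
      rw [← ofReal_norm, norm_inv, norm_pow, Complex.norm_real,
        Real.norm_of_nonneg hk.le] at this
      exact this
    rw [hconst, aux_plancherel h' i' hm']
    refine (mul_le_mul_right hle _).trans (le_of_eq ?_)
    rw [← mul_assoc, ← ENNReal.ofReal_mul (by positivity)]
    congr 2
    rw [mul_pow]
    field_simp
  · rw [eA']
    exact han
  · let v : SchwartzMap (EuclideanSpace ℝ (Fin d)) ℂ :=
      (-((k ^ 2 : ℝ) : ℂ)⁻¹) • (Laplacian.laplacian w) - w
    have hC : 0 ≤ 1 + 2 * (lam₀ ^ 2 - 1)⁻¹ := by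
      have : 0 < lam₀ ^ 2 - 1 := by nlinarith
      positivity
    have hFv : ∀ η, (FourierTransform.fourier v) η = ((‖c⁻¹ • η‖ ^ 2 - 1 : ℝ) : ℂ) * W η := by
      intro η
      have : FourierTransform.fourier v = (-((k ^ 2 : ℝ) : ℂ)⁻¹) •
          FourierTransform.fourier (Laplacian.laplacian w) - W := by
        simp only [v, W]
        rw [← FourierTransform.fourierCLM_apply (R := ℂ), map_sub, map_smul]
        rfl
      rw [this, _root_.sub_apply, _root_.smul_apply, aux_fourier_lap, norm_smul,
        Real.norm_of_nonneg (by positivity), hcdef]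
      change _ - W η = _
      have hkc : (k : ℂ) ≠ 0 := by exact_mod_cast hk.ne'
      have : (Real.pi : ℂ) ≠ 0 := by exact_mod_cast Real.pi_ne_zero
      push_cast
      simp only [smul_eq_mul]
      change _ * (_ * W η) - _ = _
      field_simp
    have hl2 : l2Norm d (fun x => -((k ^ 2 : ℝ) : ℂ)⁻¹ * lap d (fun y => w y) x - w x)
        = Real.sqrt (∫ η, ‖(FourierTransform.fourier v) η‖ ^ 2) := by
      rw [SchwartzMap.integral_norm_sq_fourier, l2Norm]
      simp_rw [aux_lap]
      rfl
    rw [hl2, wNormF, ← Real.sqrt_sq hC, ← Real.sqrt_mul (by positivity)]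
    apply Real.sqrt_le_sqrt
    have hs := Measure.integral_comp_inv_smul_of_nonneg
      (μ := (volume : Measure (EuclideanSpace ℝ (Fin d))))
      (fun ξ => (1 + ‖ξ‖ ^ 2) ^ (2 : ℝ) * ‖(1 - chiBall d lam ξ) * Fk d k (fun y => w y) ξ‖ ^ 2) hc.le
    rw [finrank_euclideanSpace_fin, smul_eq_mul] at hs
    rw [← hcdef, ← hs, ← integral_const_mul]
    refine integral_mono_of_nonneg (Filter.Eventually.of_forall fun η => by positivity) ?_
      (Filter.Eventually.of_forall fun η => ?_)
    · refine Integrable.const_mul ?_ _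
      exact ((FourierTransform.fourier v).memLp 2 volume).integrable_norm_pow (by norm_num)
    · simp only
      rw [hW, hFv]
      change _ * ‖_ * W η‖ ^ 2 ≤ _
      rw [Real.rpow_two, norm_mul, norm_mul, mul_pow, mul_pow, ← mul_assoc, ← mul_assoc]
      refine mul_le_mul_of_nonneg_right ?_ (by positivity)
      rw [← mul_pow, ← mul_pow]
      refine pow_le_pow_left₀ (by positivity) ?_ 2
      rw [Complex.norm_real]
      unfold chiBall
      split_ifs with hle
      · simp only [sub_self, norm_zero, mul_zero]
        positivity
      · rw [sub_zero, norm_one, mul_one]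
        push Not at hle
        set s := ‖c⁻¹ • η‖
        have h1 : 0 < lam₀ ^ 2 - 1 := by nlinarith
        have h2 : lam₀ ^ 2 - 1 ≤ s ^ 2 - 1 := by nlinarith
        rw [Real.norm_of_nonneg (by linarith)]
        have h3 : 1 ≤ (lam₀ ^ 2 - 1)⁻¹ * (s ^ 2 - 1) := by
          rw [← div_eq_inv_mul, le_div_iff₀ h1]; linarith
        nlinarith

end
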